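/- arXiv:1312.1867 — 2 statements merged into one kernel-verified Lean document; each statement's English description precedes it below -/
import Mathlib

section
/- Fix a positive integer k. For each n, the set of prefix k-Fibonacci paths of length n is finite; let c_n = |PM_{F_{k,n}}| be its cardinality and let PT = ∑_{n≥0} c_n z^n ∈ ℤ⟦z⟧. Then PT satisfies the quadratic equation z·((2z−1)(1−kz−z^2)+z)·PT^2 − ((1−2z)(1−kz−z^2)−z)·PT + (1−kz−z^2) = 0. -/
/-- The `k`-Fibonacci numbers: `F_{k,0} = 0`, `F_{k,1} = 1`,
`F_{k,n+2} = k * F_{k,n+1} + F_{k,n}`. -/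
def kFib (k : ℕ) : ℕ → ℕ
  | 0 => 0
  | 1 => 1
  | n + 2 => k * kFib k (n + 1) + kFib k n

/-- A step of a (colored) lattice path: a rise `up = (1,1)`, a fall `down = (1,-1)`,
or a horizontal step `horiz l c = (l,0)` of length `l` carrying a color `c`. -/
inductive KStep where
  | up : KStep
  | down : KStep
  | horiz (l c : ℕ) : KStep

/-- Horizontal displacement of a step. -/
def KStep.width : KStep → ℕ
  | .up => 1
  | .down => 1
  | .horiz l _ => l

/-- Height contribution of a step. -/
def KStep.ht : KStep → ℤ
  | .up => 1
  | .down => -1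
  | .horiz _ _ => 0

/-- A step is valid for the parameter `k` if, when it is a horizontal step of
length `l` with color `c`, we have `l ≥ 1` and `1 ≤ c ≤ F_{k,l}`. -/
def KStep.Valid (k : ℕ) : KStep → Prop
  | .up => True
  | .down => True
  | .horiz l c => 1 ≤ l ∧ 1 ≤ c ∧ c ≤ kFib k l

/-- Total horizontal displacement of a path. -/
def pathWidth (p : List KStep) : ℕ := (p.map KStep.width).sum

/-- Final height of a path. -/
def pathHt (p : List KStep) : ℤ := (p.map KStep.ht).sum

/-- `k`-Fibonacci paths of length `n`: valid steps, total width `n`,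
all partial heights nonnegative, final height `0`. -/
def KFibPath (k n : ℕ) : Set (List KStep) :=
  {p | (∀ s ∈ p, s.Valid k) ∧ pathWidth p = n ∧
       (∀ q, q <+: p → 0 ≤ pathHt q) ∧ pathHt p = 0}

/-- Grand `k`-Fibonacci paths of length `n`: valid steps, total width `n`,
final height `0` (partial heights may be negative). -/
def GrandKFibPath (k n : ℕ) : Set (List KStep) :=
  {p | (∀ s ∈ p, s.Valid k) ∧ pathWidth p = n ∧ pathHt p = 0}

/-- Prefix `k`-Fibonacci paths of length `n`: valid steps, total width `n`,
all partial heights nonnegative (final height arbitrary). -/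
def PrefixKFibPath (k n : ℕ) : Set (List KStep) :=
  {p | (∀ s ∈ p, s.Valid k) ∧ pathWidth p = n ∧
       (∀ q, q <+: p → 0 ≤ pathHt q)}

/-- Prefix grand `k`-Fibonacci paths of length `n`: valid steps, total width `n`. -/
def PrefixGrandKFibPath (k n : ℕ) : Set (List KStep) :=
  {p | (∀ s ∈ p, s.Valid k) ∧ pathWidth p = n}

theorem pathWidth_cons' (s : KStep) (p : List KStep) :
    pathWidth (s :: p) = s.width + pathWidth p := by simp [pathWidth]

theorem pathHt_cons' (s : KStep) (p : List KStep) :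
    pathHt (s :: p) = s.ht + pathHt p := by simp [pathHt]

/-- Paths starting at height `h - 1` and staying nonnegative. -/
def SP (k h n : ℕ) : Set (List KStep) :=
  {p | (∀ s ∈ p, s.Valid k) ∧ pathWidth p = n ∧ (∀ q, q <+: p → 0 < (h : ℤ) + pathHt q)}

theorem SP_one (k n : ℕ) : SP k 1 n = PrefixKFibPath k n := by
  ext p
  simp only [SP, PrefixKFibPath, Set.mem_ofPred_eq]
  refine and_congr Iff.rfl (and_congr Iff.rfl (forall_congr' fun q => imp_congr Iff.rfl ?_))
  push_cast
  omega

theorem SP_zero (k n : ℕ) : SP k 0 n = ∅ := by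
  ext p
  simp only [SP, Set.mem_ofPred_eq, Set.mem_empty_iff_false, iff_false]
  rintro ⟨_, _, h⟩
  have := h [] (List.nil_prefix)
  simp [pathHt] at this

theorem nil_mem_SP (k h n : ℕ) : [] ∈ SP k (h + 1) n ↔ n = 0 := by
  simp only [SP, Set.mem_ofPred_eq]
  constructor
  · rintro ⟨_, h, _⟩
    simpa [pathWidth] using h.symm
  · rintro rfl
    refine ⟨by simp, by simp [pathWidth], ?_⟩
    intro q hq
    rw [List.prefix_nil] at hq
    subst hq
    simp [pathHt]

theorem cons_prefix_forall (s : KStep) (p : List KStep) (h : ℤ) (hh : 0 < h) :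
    (∀ q, q <+: s :: p → 0 < h + pathHt q) ↔ ∀ q, q <+: p → 0 < h + s.ht + pathHt q := by
  constructor
  · intro H q hq
    have := H (s :: q) (List.cons_prefix_cons.2 ⟨rfl, hq⟩)
    rw [pathHt_cons'] at this
    linarith
  · intro H q hq
    cases q with
    | nil => simpa [pathHt] using hh
    | cons a q =>
      obtain ⟨rfl, hq2⟩ := List.cons_prefix_cons.1 hq
      have := H q hq2
      rw [pathHt_cons']
      linarith

theorem up_mem_SP (k h n : ℕ) (p : List KStep) :
    KStep.up :: p ∈ SP k (h + 1) (n + 1) ↔ p ∈ SP k (h + 2) n := by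
  simp only [SP, Set.mem_ofPred_eq]
  rw [cons_prefix_forall _ _ _ (by positivity), pathWidth_cons']
  simp only [List.forall_mem_cons, KStep.Valid, true_and, KStep.width, KStep.ht]
  refine and_congr Iff.rfl (and_congr (by omega)
    (forall_congr' fun q => imp_congr Iff.rfl ?_))
  push_cast
  omega

theorem down_mem_SP (k h n : ℕ) (p : List KStep) :
    KStep.down :: p ∈ SP k (h + 1) (n + 1) ↔ p ∈ SP k h n := by
  simp only [SP, Set.mem_ofPred_eq]
  rw [cons_prefix_forall _ _ _ (by positivity), pathWidth_cons']
  simp only [List.forall_mem_cons, KStep.Valid, true_and, KStep.width, KStep.ht]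
  refine and_congr Iff.rfl (and_congr (by omega)
    (forall_congr' fun q => imp_congr Iff.rfl ?_))
  push_cast
  omega

theorem horiz_mem_SP (k h n l c : ℕ) (p : List KStep) :
    KStep.horiz l c :: p ∈ SP k (h + 1) (n + 1) ↔
      ∃ i ∈ Finset.range (n + 1), ∃ d ∈ Finset.Icc 1 (kFib k (i + 1)),
        l = i + 1 ∧ c = d ∧ p ∈ SP k (h + 1) (n - i) := by
  simp only [SP, Set.mem_ofPred_eq]
  rw [cons_prefix_forall _ _ _ (by positivity), pathWidth_cons']
  simp only [List.forall_mem_cons, KStep.Valid, KStep.width, KStep.ht, add_zero,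
    Finset.mem_range, Finset.mem_Icc]
  constructor
  · rintro ⟨⟨⟨h1, h2, h3⟩, h4⟩, h5, h6⟩
    obtain ⟨i, rfl⟩ : ∃ i, l = i + 1 := ⟨l - 1, by omega⟩
    exact ⟨i, by omega, c, ⟨h2, h3⟩, rfl, rfl, h4, by omega, h6⟩
  · rintro ⟨i, hi, d, ⟨h2, h3⟩, rfl, rfl, h4, h5, h6⟩
    exact ⟨⟨⟨by omega, h2, h3⟩, h4⟩, by omega, h6⟩

theorem SP_zero_right (k h : ℕ) : SP k (h + 1) 0 = {[]} := by
  ext p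
  cases p with
  | nil => simp [nil_mem_SP]
  | cons s p =>
    simp only [Set.mem_singleton_iff, reduceCtorEq, iff_false]
    rintro ⟨h1, h2, -⟩
    rw [pathWidth_cons'] at h2
    have := h1 s (by simp)
    cases s <;> simp [KStep.width, KStep.Valid] at this h2
    omega

theorem SP_succ (k h n : ℕ) : SP k (h + 1) (n + 1) =
    (List.cons KStep.up '' SP k (h + 2) n ∪ List.cons KStep.down '' SP k h n) ∪
      ⋃ x ∈ (Finset.range (n + 1)).sigma (fun i => Finset.Icc 1 (kFib k (i + 1))),
        List.cons (KStep.horiz (x.1 + 1) x.2) '' SP k (h + 1) (n - x.1) := by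
  ext p
  cases p with
  | nil => simp [nil_mem_SP]
  | cons s p =>
    cases s with
    | up => simp [up_mem_SP]
    | down => simp [down_mem_SP]
    | horiz l c =>
      rw [horiz_mem_SP]
      simp only [Set.mem_union, Set.mem_image, List.cons.injEq, reduceCtorEq, false_and, and_false,
        exists_false, false_or, Set.mem_iUnion, Finset.mem_sigma, KStep.horiz.injEq]
      constructor
      · rintro ⟨i, hi, d, hd, rfl, rfl, hp⟩
        exact ⟨⟨i, c⟩, ⟨hi, hd⟩, p, hp, ⟨rfl, rfl⟩, rfl⟩
      · rintro ⟨⟨i, d⟩, ⟨hi, hd⟩, p', hp, ⟨rfl, rfl⟩, rfl⟩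
        exact ⟨i, hi, d, hd, rfl, rfl, hp⟩

theorem SP_finite (k n : ℕ) : ∀ h, (SP k h n).Finite := by
  induction n using Nat.strong_induction_on with
  | _ n ih =>
    intro h
    cases h with
    | zero => rw [SP_zero]; exact Set.finite_empty
    | succ h =>
      cases n with
      | zero => rw [SP_zero_right]; exact Set.finite_singleton _
      | succ n =>
        rw [SP_succ]
        refine (((ih n (by omega) _).image _).union ((ih n (by omega) _).image _)).union ?_
        refine Set.Finite.biUnion (Finset.finite_toSet _) ?_
        intro x hx
        exact (ih (n - x.1) (by omega) _).image _

theorem SP_card (k h n : ℕ) : (SP k (h + 1) (n + 1)).ncard =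
    (SP k (h + 2) n).ncard + (SP k h n).ncard +
      ∑ i ∈ Finset.range (n + 1), kFib k (i + 1) * (SP k (h + 1) (n - i)).ncard := by
  have hc : ∀ s : KStep, Function.Injective (List.cons s) := fun s => List.cons_injective
  have hbig : (⋃ x ∈ (Finset.range (n + 1)).sigma (fun i => Finset.Icc 1 (kFib k (i + 1))),
        List.cons (KStep.horiz (x.1 + 1) x.2) '' SP k (h + 1) (n - x.1)).ncard =
      ∑ i ∈ Finset.range (n + 1), kFib k (i + 1) * (SP k (h + 1) (n - i)).ncard := by
    classical
    have e : (⋃ x ∈ (Finset.range (n + 1)).sigma (fun i => Finset.Icc 1 (kFib k (i + 1))),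
        List.cons (KStep.horiz (x.1 + 1) x.2) '' SP k (h + 1) (n - x.1)) =
        ((((Finset.range (n + 1)).sigma (fun i => Finset.Icc 1 (kFib k (i + 1)))).biUnion
          fun x => (SP_finite k (n - x.1) (h + 1)).toFinset.image
            (List.cons (KStep.horiz (x.1 + 1) x.2)) : Finset (List KStep)) :
            Set (List KStep)) := by
      simp
    rw [e, Set.ncard_coe_finset, Finset.card_biUnion, Finset.sum_sigma]
    · refine Finset.sum_congr rfl fun i _ => ?_
      simp only [Finset.card_image_of_injective _ (hc _), ← Set.ncard_eq_toFinset_card]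
      rw [Finset.sum_const, Nat.card_Icc]
      simp
    · rintro ⟨i, c⟩ - ⟨j, d⟩ - hne
      rw [Function.onFun, Finset.disjoint_left]
      intro p hp hq
      simp only [Finset.mem_image] at hp hq
      obtain ⟨p1, -, rfl⟩ := hp
      obtain ⟨p2, -, h2⟩ := hq
      simp only [List.cons.injEq, KStep.horiz.injEq] at h2
      apply hne
      obtain ⟨⟨h3, h4⟩, -⟩ := h2
      have h5 : j = i := by omega
      subst h5 h4
      rfl
  have hfin := SP_finite k (n + 1) (h + 1)
  rw [SP_succ] at hfin ⊢
  have hU : (List.cons KStep.up '' SP k (h + 2) n).Finite := (SP_finite _ _ _).image _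
  have hD : (List.cons KStep.down '' SP k h n).Finite := (SP_finite _ _ _).image _
  have d1 : Disjoint (List.cons KStep.up '' SP k (h + 2) n)
      (List.cons KStep.down '' SP k h n) := by
    rw [Set.disjoint_left]
    rintro _ ⟨p, -, rfl⟩ ⟨q, -, hq⟩
    simp at hq
  rw [Set.ncard_union_eq ?_ (hU.union hD) (hfin.subset Set.subset_union_right),
    Set.ncard_union_eq d1 hU hD, hbig, Set.ncard_image_of_injective _ (hc _),
    Set.ncard_image_of_injective _ (hc _)]
  rw [Set.disjoint_left]
  rintro p hp hq
  simp only [Set.mem_iUnion] at hq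
  obtain ⟨x, -, q, -, rfl⟩ := hq
  simp at hp

open PowerSeries in
/-- Generating function of `SP k h`. -/
noncomputable def SA (k h : ℕ) : PowerSeries ℤ := PowerSeries.mk fun n => ((SP k h n).ncard : ℤ)

/-- Shifted generating function of the `k`-Fibonacci numbers. -/
noncomputable def FG (k : ℕ) : PowerSeries ℤ := PowerSeries.mk fun n => (kFib k (n + 1) : ℤ)

open PowerSeries in
theorem FG_eq (k : ℕ) : FG k * (1 - (k : PowerSeries ℤ) * X - X ^ 2) = 1 := by
  have : FG k = 1 + (k : PowerSeries ℤ) * (X * FG k) + X * (X * FG k) := by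
    have hk : (k : PowerSeries ℤ) = C (k : ℤ) := by simp
    rw [hk]
    ext n
    match n with
    | 0 => simp [FG, kFib]
    | 1 =>
      simp only [map_add, coeff_C_mul, coeff_succ_X_mul, FG, coeff_mk, coeff_one]
      simp [kFib]
    | n + 2 =>
      simp only [map_add, coeff_C_mul, coeff_succ_X_mul, FG, coeff_mk, coeff_one]
      simp [kFib]
  linear_combination this

open PowerSeries in
theorem SA_rec (k h : ℕ) : SA k (h + 1) =
    1 + X * (SA k (h + 2) + SA k h + FG k * SA k (h + 1)) := by
  ext n
  cases n with
  | zero => simp [SA, SP_zero_right]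
  | succ n =>
    rw [map_add, coeff_succ_X_mul, map_add, map_add, coeff_mul,
      Finset.Nat.sum_antidiagonal_eq_sum_range_succ_mk]
    simp [SA, FG, SP_card, coeff_one]

theorem SA_zero (k : ℕ) : SA k 0 = 0 := by
  ext n
  simp [SA, SP_zero]

open PowerSeries in
theorem rec_unique (F : PowerSeries ℤ) (A B : ℕ → PowerSeries ℤ) (h0 : A 0 = B 0)
    (hA : ∀ h, A (h + 1) = 1 + X * (A (h + 2) + A h + F * A (h + 1)))
    (hB : ∀ h, B (h + 1) = 1 + X * (B (h + 2) + B h + F * B (h + 1))) (h : ℕ) : A h = B h := by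
  have key : ∀ n h, (X : PowerSeries ℤ) ^ n ∣ A h - B h := by
    intro n
    induction n with
    | zero => simp
    | succ n ih =>
      intro h
      cases h with
      | zero => simp [h0]
      | succ h =>
        have e : A (h + 1) - B (h + 1) = X * ((A (h + 2) - B (h + 2)) + (A h - B h)
            + F * (A (h + 1) - B (h + 1))) := by
          linear_combination hA h - hB h
        rw [e, pow_succ']
        exact mul_dvd_mul_left _ (dvd_add (dvd_add (ih _) (ih _)) ((ih _).mul_left _))
  rw [← sub_eq_zero]
  ext n
  exact X_pow_dvd_iff.1 (key (n + 1) h) n (by omega)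

open PowerSeries in
/-- Existence of the Motzkin-type series. -/
theorem exists_T (F : PowerSeries ℤ) :
    ∃ T : PowerSeries ℤ, T * (1 - X * F) = 1 + X ^ 2 * T ^ 2 := by
  obtain ⟨E, hE⟩ : ∃ E, (1 - X * F) * E = 1 := by
    have : IsUnit (1 - X * F) := by
      rw [PowerSeries.isUnit_iff_constantCoeff]; simp
    exact this.exists_right_inv
  have hs : HasSubst (X ^ 2 * E ^ 2 : PowerSeries ℤ) :=
    HasSubst.of_constantCoeff_zero' (by simp)
  set w := (X ^ 2 * E ^ 2 : PowerSeries ℤ) with hw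
  set c : PowerSeries ℤ := (catalanSeries.map (Nat.castRingHom ℤ)) with hc
  have h1 : c ^ 2 * X + 1 = c := by
    have := congrArg (PowerSeries.map (Nat.castRingHom ℤ)) catalanSeries_sq_mul_X_add_one
    simpa using this
  have h2 := congrArg (substAlgHom (R := ℤ) hs) h1
  rw [map_add, map_mul, map_pow, map_one, substAlgHom_X] at h2
  set d : PowerSeries ℤ := substAlgHom (R := ℤ) hs c with hd
  have h3 : d ^ 2 * (X ^ 2 * E ^ 2) + 1 = d := h2
  refine ⟨d * E, ?_⟩
  linear_combination d * hE - h3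

open PowerSeries in
theorem SA_quadratic (k : ℕ) :
    X * (2 * X - 1 + X * FG k) * SA k 1 ^ 2 + (2 * X - 1 + X * FG k) * SA k 1 + 1 = 0 := by
  obtain ⟨T, hT⟩ := exists_T (FG k)
  have hT0 : T ≠ 0 := by
    rintro rfl
    simp at hT
  obtain ⟨E, hE⟩ : ∃ E, (1 - X * T) * E = 1 := by
    have : IsUnit (1 - X * T) := by
      rw [PowerSeries.isUnit_iff_constantCoeff]; simp
    exact this.exists_right_inv
  have hB : SA k 1 = T * E * ∑ j ∈ Finset.range 1, (X * T) ^ j := by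
    refine rec_unique (FG k) (SA k) (fun h => T * E * ∑ j ∈ Finset.range h, (X * T) ^ j)
      (by simp [SA_zero]) (SA_rec k) ?_ 1
    intro h
    have h1 : ∀ m, ∑ j ∈ Finset.range (m + 1), (X * T) ^ j =
        X * T * ∑ j ∈ Finset.range m, (X * T) ^ j + 1 := by
      intro m
      rw [Finset.sum_range_succ', Finset.mul_sum]
      simp [pow_succ']
    simp only [h1 (h + 1), h1 h]
    set G := ∑ j ∈ Finset.range h, (X * T) ^ j
    linear_combination (E * (X * T * G + 1)) * hT + hE
  simp only [Finset.range_one, Finset.sum_singleton, pow_zero, mul_one] at hB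
  have hP : SA k 1 * (1 - X * T) = T := by rw [hB]; linear_combination T * hE
  have hne : (1 - X * T) ≠ 0 := by
    intro h; rw [h] at hE; simp at hE
  have : (1 - X * T) ^ 2 * (X * (2 * X - 1 + X * FG k) * SA k 1 ^ 2 + (2 * X - 1 + X * FG k) * SA k 1 + 1) = 0 := by
    have : (1 - X * T) ^ 2 * (X * (2 * X - 1 + X * FG k) * SA k 1 ^ 2 + (2 * X - 1 + X * FG k) * SA k 1 + 1) = X * (2 * X - 1 + X * FG k) * (SA k 1 * (1 - X * T)) ^ 2 + (2 * X - 1 + X * FG k) * (SA k 1 * (1 - X * T)) * (1 - X * T) + (1 - X * T) ^ 2 := by ring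
    rw [this, hP]
    linear_combination - hT
  exact (mul_eq_zero.1 this).resolve_left (pow_ne_zero 2 hne)

/-- Fix a positive integer `k`. For each `n` the set of prefix `k`-Fibonacci paths of
length `n` is finite, and the generating function `PT = ∑_{n≥0} |PM_{F_{k,n}}| z^n ∈ ℤ⟦z⟧`
satisfies `z·((2z−1)(1−kz−z²)+z)·PT² − ((1−2z)(1−kz−z²)−z)·PT + (1−kz−z²) = 0`. -/
theorem prefixKFibPath_gf_quadratic (k : ℕ) (hk : 0 < k) :
    (∀ n, (PrefixKFibPath k n).Finite) ∧
    (let PT : PowerSeries ℤ := PowerSeries.mk fun n => ((PrefixKFibPath k n).ncard : ℤ)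
     PowerSeries.X *
         ((2 * PowerSeries.X - 1) *
            (1 - (k : PowerSeries ℤ) * PowerSeries.X - PowerSeries.X ^ 2) +
          PowerSeries.X) * PT ^ 2
       - ((1 - 2 * PowerSeries.X) *
            (1 - (k : PowerSeries ℤ) * PowerSeries.X - PowerSeries.X ^ 2) -
          PowerSeries.X) * PT
       + (1 - (k : PowerSeries ℤ) * PowerSeries.X - PowerSeries.X ^ 2) = 0) := by
  refine ⟨fun n => by rw [← SP_one]; exact SP_finite k n 1, ?_⟩
  intro PT
  have hPT : PT = SA k 1 := by
    simp only [PT, SA, SP_one]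
  rw [hPT]
  have h1 := SA_quadratic k
  have h2 := FG_eq k
  linear_combination (1 - (k : PowerSeries ℤ) * PowerSeries.X - PowerSeries.X ^ 2) * h1 -
    (PowerSeries.X ^ 2 * SA k 1 ^ 2 + PowerSeries.X * SA k 1) * h2
end

section
/- Fix a positive integer k. For each n, the set of prefix grand k-Fibonacci paths of length n is finite; let d_n = |PM*_{F_{k,n}}| be its cardinality. Then in ℤ⟦z⟧ one has the identity (1 − (k+3)z − (1−2k)z^2 + 2z^3) · (∑_{n≥0} d_n z^n) = 1 − kz − z^2; equivalently, the generating function of the prefix grand k-Fibonacci paths is the rational function (1−kz−z^2)/(1−(k+3)z−(1−2k)z^2+2z^3). -/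
open Classical in
/-- The valid steps of width `l`. -/
noncomputable def stepSet (k l : ℕ) : Finset KStep :=
  (if l = 1 then {KStep.up, KStep.down} else ∅) ∪ (Finset.Icc 1 (kFib k l)).image (KStep.horiz l)

open Classical in
lemma mem_stepSet (k l : ℕ) (hl : 1 ≤ l) (s : KStep) :
    s ∈ stepSet k l ↔ s.Valid k ∧ s.width = l := by
  unfold stepSet
  cases s with
  | up => by_cases h : l = 1 <;> simp [h, KStep.Valid, KStep.width, eq_comm]
  | down => by_cases h : l = 1 <;> simp [h, KStep.Valid, KStep.width, eq_comm]
  | horiz a c =>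
    have h1 : ¬ (KStep.horiz a c ∈ (if l = 1 then {KStep.up, KStep.down} else ∅ : Finset KStep)) := by
      split_ifs <;> simp
    simp only [Finset.mem_union, h1, false_or, Finset.mem_image, Finset.mem_Icc, KStep.Valid,
      KStep.width, KStep.horiz.injEq]
    constructor
    · rintro ⟨x, hx, rfl, rfl⟩
      exact ⟨⟨hl, hx⟩, rfl⟩
    · rintro ⟨⟨_, hx⟩, rfl⟩
      exact ⟨c, hx, rfl, rfl⟩

open Classical in
lemma card_stepSet (k l : ℕ) :
    (stepSet k l).card = kFib k l + if l = 1 then 2 else 0 := by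
  unfold stepSet
  rw [Finset.card_union_of_disjoint, Finset.card_image_of_injective]
  · split_ifs <;> simp [add_comm]
  · intro a b h
    simpa using h
  · rw [Finset.disjoint_left]
    intro a ha hb
    obtain ⟨x, _, rfl⟩ := Finset.mem_image.1 hb
    split_ifs at ha <;> simp at ha

lemma valid_width_pos {k : ℕ} {s : KStep} (h : s.Valid k) : 1 ≤ s.width := by
  cases s <;> simp_all [KStep.Valid, KStep.width]

lemma path_zero (k : ℕ) : PrefixGrandKFibPath k 0 = {[]} := by
  ext p
  cases p with
  | nil => simp [PrefixGrandKFibPath, pathWidth]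
  | cons s p =>
    simp only [PrefixGrandKFibPath, pathWidth, Set.mem_ofPred_eq, List.map_cons, List.sum_cons,
      Set.mem_singleton_iff, reduceCtorEq, iff_false, not_and]
    intro h h2
    have := valid_width_pos (h s (by simp))
    omega

lemma path_succ (k n : ℕ) : PrefixGrandKFibPath k (n + 1) =
    ⋃ ij ∈ Finset.HasAntidiagonal.antidiagonal n, Set.image (fun x : KStep × List KStep => x.1 :: x.2)
      ((stepSet k (ij.1 + 1) : Set KStep) ×ˢ PrefixGrandKFibPath k ij.2) := by
  ext p
  simp only [Set.mem_iUnion, Set.mem_image, Set.mem_prod, Finset.mem_coe, exists_prop]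
  constructor
  · intro hp
    cases p with
    | nil => simp [PrefixGrandKFibPath, pathWidth] at hp
    | cons s p =>
      obtain ⟨h1, h2⟩ := hp
      simp only [List.mem_cons, forall_eq_or_imp] at h1
      have h3 := valid_width_pos h1.1
      have h4 : s.width + pathWidth p = n + 1 := by simpa [pathWidth] using h2
      refine ⟨(s.width - 1, pathWidth p), ?_, (s, p), ⟨?_, h1.2, rfl⟩, rfl⟩
      · simp only [Finset.HasAntidiagonal.mem_antidiagonal]; omega
      · rw [mem_stepSet _ _ (by omega)]
        exact ⟨h1.1, by simp only; omega⟩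
  · rintro ⟨⟨i, j⟩, hij, ⟨s, p⟩, ⟨hs, hp1, hp2⟩, rfl⟩
    simp only [Finset.HasAntidiagonal.mem_antidiagonal] at hij
    rw [mem_stepSet _ _ (by omega)] at hs
    simp only at hs hp1 hp2
    refine ⟨?_, ?_⟩
    · simp only [List.mem_cons, forall_eq_or_imp]
      exact ⟨hs.1, hp1⟩
    · have : pathWidth (s :: p) = s.width + pathWidth p := by simp [pathWidth]
      simp only [this]; omega

lemma path_finite (k n : ℕ) : (PrefixGrandKFibPath k n).Finite := by
  induction n using Nat.strong_induction_on with
  | _ n ih =>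
    cases n with
    | zero => rw [path_zero]; exact Set.finite_singleton _
    | succ n =>
      rw [path_succ]
      refine Set.Finite.biUnion (Finset.finite_toSet _) ?_
      intro ij hij
      have := Finset.HasAntidiagonal.mem_antidiagonal.1 hij
      exact ((Finset.finite_toSet _).prod (ih _ (by omega))).image _

lemma cons_injective : Function.Injective (fun x : KStep × List KStep => x.1 :: x.2) := by
  rintro ⟨a, b⟩ ⟨c, d⟩ h
  simpa using h

open Classical in
lemma card_succ (k n : ℕ) : (PrefixGrandKFibPath k (n + 1)).ncard =
    ∑ ij ∈ Finset.HasAntidiagonal.antidiagonal n,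
      (stepSet k (ij.1 + 1)).card * (PrefixGrandKFibPath k ij.2).ncard := by
  have h : PrefixGrandKFibPath k (n + 1) = (((Finset.HasAntidiagonal.antidiagonal n).biUnion fun ij =>
      ((stepSet k (ij.1 + 1)) ×ˢ (path_finite k ij.2).toFinset).image
        (fun x : KStep × List KStep => x.1 :: x.2) : Finset (List KStep)) : Set (List KStep)) := by
    rw [path_succ]
    simp only [Finset.coe_biUnion, Finset.coe_image, Finset.coe_product,
      Set.Finite.coe_toFinset, Finset.mem_coe]
  rw [h, Set.ncard_coe_finset, Finset.card_biUnion]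
  · refine Finset.sum_congr rfl fun ij _ => ?_
    rw [Finset.card_image_of_injective _ cons_injective, Finset.card_product,
      Set.ncard_eq_toFinset_card _ (path_finite k ij.2)]
  · rintro ⟨i, j⟩ hij ⟨i', j'⟩ hij' hne
    rw [Function.onFun, Finset.disjoint_left]
    intro p hp hp'
    obtain ⟨⟨s, q⟩, h1, rfl⟩ := Finset.mem_image.1 hp
    obtain ⟨⟨s', q'⟩, h1', h2⟩ := Finset.mem_image.1 hp'
    obtain ⟨rfl, rfl⟩ := List.cons.inj h2
    have a1 := ((mem_stepSet _ _ (by omega) _).1 (Finset.mem_product.1 h1).1).2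
    have a2 := ((mem_stepSet _ _ (by omega) _).1 (Finset.mem_product.1 h1').1).2
    simp at hij hij' a1 a2
    apply hne
    ext <;> simp only <;> omega

lemma kFib_gf (k : ℕ) : (PowerSeries.mk fun n => (kFib k (n + 1) : ℤ)) =
    1 + (k : PowerSeries ℤ) * (PowerSeries.X * PowerSeries.mk fun n => (kFib k (n + 1) : ℤ))
      + PowerSeries.X * (PowerSeries.X * PowerSeries.mk fun n => (kFib k (n + 1) : ℤ)) := by
  have hc : (k : PowerSeries ℤ) = PowerSeries.C (k : ℤ) := by simp
  rw [hc]
  ext n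
  rcases n with _ | _ | n
  · simp [kFib, PowerSeries.coeff_zero_eq_constantCoeff]
  · simp only [map_add, PowerSeries.coeff_C_mul, PowerSeries.coeff_succ_X_mul,
      PowerSeries.coeff_mk]
    simp [kFib, PowerSeries.coeff_one]
  · simp only [map_add, PowerSeries.coeff_C_mul, PowerSeries.coeff_succ_X_mul,
      PowerSeries.coeff_mk]
    simp [kFib, PowerSeries.coeff_one]

lemma path_gf (k : ℕ) : (PowerSeries.mk fun n => ((PrefixGrandKFibPath k n).ncard : ℤ)) =
    1 + PowerSeries.X * (((PowerSeries.mk fun n => (kFib k (n + 1) : ℤ)) + 2) *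
      PowerSeries.mk fun n => ((PrefixGrandKFibPath k n).ncard : ℤ)) := by
  have hW : ((PowerSeries.mk fun n => (kFib k (n + 1) : ℤ)) + 2) =
      PowerSeries.mk fun n => ((stepSet k (n + 1)).card : ℤ) := by
    have h2 : (2 : PowerSeries ℤ) = PowerSeries.C (2 : ℤ) := by simp
    rw [h2]
    ext n
    simp only [map_add, PowerSeries.coeff_mk, card_stepSet, PowerSeries.coeff_C]
    push_cast
    simp
  rw [hW]
  ext n
  cases n with
  | zero => simp [path_zero]
  | succ n =>
    rw [map_add, PowerSeries.coeff_succ_X_mul, PowerSeries.coeff_mul]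
    simp [card_succ, PowerSeries.coeff_one]

/-- Fix a positive integer `k`. For each `n` the set of prefix grand `k`-Fibonacci paths
of length `n` is finite, and in `ℤ⟦z⟧` one has
`(1 − (k+3)z − (1−2k)z² + 2z³) · (∑_{n≥0} |PM*_{F_{k,n}}| z^n) = 1 − kz − z²`. -/
theorem prefixGrandKFibPath_gf (k : ℕ) (hk : 0 < k) :
    (∀ n, (PrefixGrandKFibPath k n).Finite) ∧
    (1 - ((k : PowerSeries ℤ) + 3) * PowerSeries.X
        - (1 - 2 * (k : PowerSeries ℤ)) * PowerSeries.X ^ 2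
        + 2 * PowerSeries.X ^ 3) *
      PowerSeries.mk (fun n => ((PrefixGrandKFibPath k n).ncard : ℤ)) =
      1 - (k : PowerSeries ℤ) * PowerSeries.X - PowerSeries.X ^ 2 := by
  refine ⟨path_finite k, ?_⟩
  have h1 := kFib_gf k
  have h2 := path_gf k
  generalize (PowerSeries.mk fun n => (kFib k (n + 1) : ℤ)) = F at h1 h2
  generalize (PowerSeries.mk fun n => ((PrefixGrandKFibPath k n).ncard : ℤ)) = D at h2 ⊢
  linear_combination (1 - (k : PowerSeries ℤ) * PowerSeries.X - PowerSeries.X ^ 2) * h2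
    + PowerSeries.X * D * h1
end
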